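/- Under the hypotheses M_k → M, a+θ ≠ 0, b ≠ 0, bd ≠ aθ, the tails ξ_k of the continued fraction with β_k = b̃_k⁻¹d̃_{k+1}⁻¹ and α_k = ã_k b̃_k⁻¹d̃_{k+1}⁻¹ converge: lim_{k→∞} ξ_k = ϱ⁻¹, where ϱ is the larger eigenvalue of M. In particular, with α = (a+θ)/(bd−aθ) and β = (bd−aθ)⁻¹, one has (α/2)(√(1 + 4β/α²) − 1) = ϱ⁻¹. -/

import Mathlib

open Filter

/-- Truncated tails of the continued fraction `(t k + c k * ξ (k + 1))⁻¹` stay in `[0, ν k]`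
whenever these intervals are mapped into each other. -/
theorem truncated_tail_bounds {t c ν : ℕ → ℝ} {ξ : ℕ → ℕ → ℝ} {K : ℕ}
    (hdiag : ∀ n, K ≤ n → ξ n n = (t n)⁻¹)
    (hrec : ∀ k n, K ≤ k → k < n → ξ k n = (t k + c k * ξ (k + 1) n)⁻¹)
    (hν : ∀ k, K ≤ k → 0 < ν k)
    (hmap : ∀ k, K ≤ k → ∀ x, 0 ≤ x → x ≤ ν (k + 1) → (ν k)⁻¹ ≤ t k + c k * x)
    {k n : ℕ} (hk : K ≤ k) (hkn : k ≤ n) : 0 ≤ ξ k n ∧ ξ k n ≤ ν k := by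
  have key : ∀ j, K ≤ j → ∀ x, 0 ≤ x → x ≤ ν (j + 1) →
      0 ≤ (t j + c j * x)⁻¹ ∧ (t j + c j * x)⁻¹ ≤ ν j := fun j hj x hx hx' ↦ by
    have h := hmap j hj x hx hx'
    have hpos := inv_pos.2 (hν j hj)
    exact ⟨inv_nonneg.2 (hpos.le.trans h), inv_le_of_inv_le₀ (hν j hj) h⟩
  induction hkn using Nat.decreasingInduction with
  | self => simpa [hdiag n hk] using key n hk 0 le_rfl (hν (n + 1) (by lia)).le
  | of_succ j hj ih =>
    obtain ⟨h0, h1⟩ := ih (by lia)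
    rw [hrec j n hk hj]
    exact key j hk _ h0 h1

/-- The limiting tails satisfy the same bounds and the continued fraction recursion. -/
theorem limit_tail_bounds {t c ν : ℕ → ℝ} {ξ : ℕ → ℕ → ℝ} {ξt : ℕ → ℝ} {K : ℕ}
    (hdiag : ∀ n, K ≤ n → ξ n n = (t n)⁻¹)
    (hrec : ∀ k n, K ≤ k → k < n → ξ k n = (t k + c k * ξ (k + 1) n)⁻¹)
    (hν : ∀ k, K ≤ k → 0 < ν k)
    (hmap : ∀ k, K ≤ k → ∀ x, 0 ≤ x → x ≤ ν (k + 1) → (ν k)⁻¹ ≤ t k + c k * x)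
    (hlim : ∀ k, Tendsto (fun n ↦ ξ k n) atTop (nhds (ξt k))) {k : ℕ} (hk : K ≤ k) :
    0 ≤ ξt k ∧ ξt k ≤ ν k ∧ ξt k * (t k + c k * ξt (k + 1)) = 1 := by
  have hb : ∀ᶠ n in atTop, 0 ≤ ξ k n ∧ ξ k n ≤ ν k := by
    filter_upwards [eventually_ge_atTop k] with n hn
    exact truncated_tail_bounds hdiag hrec hν hmap hk hn
  refine ⟨ge_of_tendsto (hlim k) (hb.mono fun _ h ↦ h.1),
    le_of_tendsto (hlim k) (hb.mono fun _ h ↦ h.2), ?_⟩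
  have hl := (hlim k).mul (((hlim (k + 1)).const_mul (c k)).const_add (t k))
  refine tendsto_nhds_unique (hl.congr' ?_) tendsto_const_nhds
  filter_upwards [eventually_gt_atTop k] with n hn
  obtain ⟨h0, h1⟩ := truncated_tail_bounds hdiag hrec hν hmap (show K ≤ k + 1 by lia) hn
  have h := hmap k hk _ h0 h1
  have hpos := inv_pos.2 (hν k hk)
  rw [hrec k n hk hn]
  exact inv_mul_cancel₀ (hpos.trans_le h).ne'

/-- Cluster points of a bounded solution of an asymptotically autonomous continued fraction
recursion are backward invariant under the limiting recursion. -/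
theorem exists_mapClusterPt_of_recursion {t c y : ℕ → ℝ} {s D B : ℝ}
    (ht : Tendsto t atTop (nhds s)) (hc : Tendsto c atTop (nhds D))
    (hB : ∀ᶠ k in atTop, y k ∈ Set.Icc 0 B)
    (hrec : ∀ᶠ k in atTop, y k * (t k + c k * y (k + 1)) = 1)
    {x : ℝ} (hx : MapClusterPt x atTop y) :
    ∃ x', MapClusterPt x' atTop y ∧ x * (s + D * x') = 1 := by
  obtain ⟨U, hU, hUx⟩ := mapClusterPt_iff_ultrafilter.1 hx
  have hshift : Tendsto (fun k : ℕ ↦ k + 1) U atTop := (tendsto_add_atTop_nat 1).mono_left hU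
  have hmem : ∀ᶠ k in (U : Filter ℕ), y (k + 1) ∈ Set.Icc 0 B := hshift.eventually hB
  obtain ⟨x', -, hx'⟩ := isCompact_Icc.ultrafilter_le_nhds' (U.map fun k ↦ y (k + 1)) hmem
  have hx'' : Tendsto (fun k ↦ y (k + 1)) U (nhds x') := hx'
  refine ⟨x', mapClusterPt_iff_ultrafilter.2 ⟨U.map fun k ↦ k + 1, hshift, hx''⟩, ?_⟩
  have hl := hUx.mul ((ht.mono_left hU).add ((hc.mono_left hU).mul hx''))
  exact tendsto_nhds_unique (hl.congr' (hU hrec)) tendsto_const_nhds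

/-- A bounded sequence converges once the least and the greatest cluster point are both equal
to the prospective limit. -/
theorem tendsto_of_extreme_mapClusterPt {y : ℕ → ℝ} {B τ : ℝ}
    (hB : ∀ᶠ k in atTop, y k ∈ Set.Icc 0 B)
    (h : ∀ m M, MapClusterPt m atTop y → MapClusterPt M atTop y →
      (∀ x, MapClusterPt x atTop y → m ≤ x ∧ x ≤ M) → m = τ ∧ M = τ) :
    Tendsto y atTop (nhds τ) := by
  have hsub : {x | MapClusterPt x atTop y} ⊆ Set.Icc 0 B := fun x hx ↦
    isClosed_Icc.mem_of_mapClusterPt hx hB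
  have hcomp : IsCompact {x | MapClusterPt x atTop y} :=
    isCompact_Icc.of_isClosed_subset isClosed_setOfPred_clusterPt hsub
  have hne : {x | MapClusterPt x atTop y}.Nonempty := by
    obtain ⟨x, -, hx⟩ := isCompact_Icc.exists_mapClusterPt_of_frequently hB.frequently
    exact ⟨x, hx⟩
  obtain ⟨m, hm, hm'⟩ := hcomp.exists_isLeast hne
  obtain ⟨M, hM, hM'⟩ := hcomp.exists_isGreatest hne
  obtain ⟨rfl, h2⟩ := h m M hm hM fun x hx ↦ ⟨hm' hx, hM' hx⟩
  refine isCompact_Icc.le_nhds_of_unique_clusterPt (Filter.mem_map.2 hB) fun x _ hx ↦ ?_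
  exact le_antisymm ((hM' hx).trans_eq h2) (hm' hx)

/-- Convergence for a positive limiting partial numerator. -/
theorem tendsto_of_recursion_of_pos {t c y : ℕ → ℝ} {s D B τ : ℝ} (hs : 0 < s) (hD : 0 < D)
    (ht : Tendsto t atTop (nhds s)) (hc : Tendsto c atTop (nhds D))
    (hB : ∀ᶠ k in atTop, y k ∈ Set.Icc 0 B)
    (hrec : ∀ᶠ k in atTop, y k * (t k + c k * y (k + 1)) = 1)
    (hτ : 0 < τ) (hfix : τ * (s + D * τ) = 1) : Tendsto y atTop (nhds τ) := by
  refine tendsto_of_extreme_mapClusterPt hB fun m M hm hM hext ↦ ?_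
  have hm0 : 0 ≤ m := (isClosed_Icc.mem_of_mapClusterPt hm hB).1
  obtain ⟨p, hp, hmp⟩ := exists_mapClusterPt_of_recursion ht hc hB hrec hm
  obtain ⟨q, hq, hMq⟩ := exists_mapClusterPt_of_recursion ht hc hB hrec hM
  have hmM := (hext m hm).2
  have h1 : m * D * p ≤ m * D * M := mul_le_mul_of_nonneg_left (hext p hp).2 (by positivity)
  have h2 : M * D * m ≤ M * D * q :=
    mul_le_mul_of_nonneg_left (hext q hq).1 (mul_nonneg (hm0.trans hmM) hD.le)
  have h3 : M ≤ m := le_of_mul_le_mul_left (by nlinarith : s * M ≤ s * m) hs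
  obtain rfl : m = M := le_antisymm hmM h3
  have h4 : m * (s + D * m) = 1 := by nlinarith
  have h5 : (m - τ) * (s + D * (m + τ)) = 0 := by linear_combination h4 - hfix
  have h6 : m = τ := sub_eq_zero.1 ((mul_eq_zero.1 h5).resolve_right (by positivity))
  exact ⟨h6, h6⟩

/-- Convergence for a negative limiting partial numerator, provided the solution is
asymptotically bounded by the vertex of the fixed point equation. -/
theorem tendsto_of_recursion_of_neg {t c y ν : ℕ → ℝ} {s D τ : ℝ} (hD : D < 0)
    (ht : Tendsto t atTop (nhds s)) (hc : Tendsto c atTop (nhds D))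
    (hν : Tendsto ν atTop (nhds (-s / (2 * D))))
    (hy : ∀ᶠ k in atTop, 0 ≤ y k ∧ y k ≤ ν k)
    (hrec : ∀ᶠ k in atTop, y k * (t k + c k * y (k + 1)) = 1)
    (hτ : τ ≤ -s / (2 * D)) (hfix : τ * (s + D * τ) = 1) : Tendsto y atTop (nhds τ) := by
  have hB : ∀ᶠ k in atTop, y k ∈ Set.Icc 0 (-s / (2 * D) + 1) := by
    filter_upwards [hy, hν.eventually_le_const (lt_add_one _)] with k hk hk'
    exact ⟨hk.1, hk.2.trans hk'⟩
  refine tendsto_of_extreme_mapClusterPt hB fun m M hm hM hext ↦ ?_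
  have hm0 : 0 ≤ m := (isClosed_Icc.mem_of_mapClusterPt hm hB).1
  obtain ⟨p, hp, hmp⟩ := exists_mapClusterPt_of_recursion ht hc hB hrec hm
  obtain ⟨q, hq, hMq⟩ := exists_mapClusterPt_of_recursion ht hc hB hrec hM
  have hmM := (hext m hm).2
  have hMv : M ≤ -s / (2 * D) := by
    obtain ⟨U, hU, hUM⟩ := mapClusterPt_iff_ultrafilter.1 hM
    exact le_of_tendsto_of_tendsto hUM (hν.mono_left hU) (hU (hy.mono fun _ h ↦ h.2))
  have h1 : m * -D * m ≤ m * -D * p :=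
    mul_le_mul_of_nonneg_left (hext p hp).1 (mul_nonneg hm0 (neg_pos.2 hD).le)
  have h2 : M * -D * q ≤ M * -D * M :=
    mul_le_mul_of_nonneg_left (hext q hq).2 (mul_nonneg (hm0.trans hmM) (neg_pos.2 hD).le)
  have hmono : ∀ u v, u < v → v ≤ -s / (2 * D) → u * (s + D * u) < v * (s + D * v) := by
    intro u v huv hv
    rw [le_div_iff_of_neg (by linarith)] at hv
    have : 0 < (v - u) * (s + D * (u + v)) :=
      mul_pos (sub_pos.2 huv) (by nlinarith)
    linarith
  have h3 : M ≤ τ := by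
    by_contra! h
    linarith [hmono _ _ h hMv]
  have h4 : τ ≤ m := by
    by_contra! h
    linarith [hmono _ _ h hτ]
  exact ⟨le_antisymm (hmM.trans h3) h4, le_antisymm h3 (h4.trans hmM)⟩

/-- Under `M_k → M`, `a+θ ≠ 0`, `b ≠ 0`, `bd ≠ aθ`, the tails `ξt k` of
the continued fraction with `β k = (b̃ k)⁻¹ (d̃ (k+1))⁻¹`,
`α k = ã k (b̃ k)⁻¹ (d̃ (k+1))⁻¹` converge to `ϱ⁻¹`; in particular, with
`α = (a+θ)/(bd−aθ)` and `β = (bd−aθ)⁻¹`, one has `(α/2)(√(1+4β/α²) − 1) = ϱ⁻¹`. -/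
theorem stmt19 (a b d θ : ℕ → ℝ)
    (hnn : ∀ k, 0 ≤ a k ∧ 0 ≤ b k ∧ 0 ≤ d k ∧ 0 ≤ θ k)
    (hb0 : ∀ k, b k ≠ 0)
    (a' b' d' θ' : ℝ)
    (ha : Tendsto a atTop (nhds a')) (hbl : Tendsto b atTop (nhds b'))
    (hd : Tendsto d atTop (nhds d')) (hθl : Tendsto θ atTop (nhds θ'))
    (h1 : a' + θ' ≠ 0) (h2 : b' ≠ 0) (h3 : b' * d' ≠ a' * θ')
    (ta tb td : ℕ → ℝ)
    (hta : ∀ k, ta k = a k + b k * θ (k+1) / b (k+1))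
    (htb : ∀ k, tb k = b k)
    (htd : ∀ k, td k = d k - a k * θ k / b k)
    (α β : ℕ → ℝ)
    (hβ : ∀ k, β k = (tb k)⁻¹ * (td (k+1))⁻¹)
    (hα : ∀ k, α k = ta k * (tb k)⁻¹ * (td (k+1))⁻¹)
    (ξ : ℕ → ℕ → ℝ)
    (hdiag : ∀ n, ξ n n = β n / α n)
    (hrec : ∀ k n, k < n → ξ k n = β k / (α k + ξ (k+1) n))
    (ξt : ℕ → ℝ)
    (hξtlim : ∀ k, Tendsto (fun n => ξ k n) atTop (nhds (ξt k)))
    (ϱ : ℝ)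
    (hϱ : ϱ = (a' + θ' + Real.sqrt ((a' + θ') ^ 2 + 4 * (b' * d' - a' * θ'))) / 2) :
    Tendsto ξt atTop (nhds ϱ⁻¹) ∧
    ((a' + θ') / (b' * d' - a' * θ') / 2 *
      (Real.sqrt (1 + 4 * (b' * d' - a' * θ')⁻¹ /
        ((a' + θ') / (b' * d' - a' * θ')) ^ 2) - 1) = ϱ⁻¹) := by
  have ha0 : 0 ≤ a' := ge_of_tendsto' ha fun k ↦ (hnn k).1
  have hb0' : 0 ≤ b' := ge_of_tendsto' hbl fun k ↦ (hnn k).2.1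
  have hd0 : 0 ≤ d' := ge_of_tendsto' hd fun k ↦ (hnn k).2.2.1
  have hθ0 : 0 ≤ θ' := ge_of_tendsto' hθl fun k ↦ (hnn k).2.2.2
  obtain ⟨s, hs⟩ : ∃ s, s = a' + θ' := ⟨_, rfl⟩
  obtain ⟨D, hD⟩ : ∃ D, D = b' * d' - a' * θ' := ⟨_, rfl⟩
  have hs0 : 0 < s := hs ▸ lt_of_le_of_ne (add_nonneg ha0 hθ0) h1.symm
  have hD0 : D ≠ 0 := hD ▸ sub_ne_zero.2 h3
  have hdisc' : s ^ 2 + 4 * D = (a' - θ') ^ 2 + 4 * (b' * d') := by rw [hs, hD]; ring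
  have hdisc : 0 ≤ s ^ 2 + 4 * D := by rw [hdisc']; positivity
  rw [← hs, ← hD] at hϱ ⊢
  obtain ⟨r, hr⟩ : ∃ r, r = √(s ^ 2 + 4 * D) := ⟨_, rfl⟩
  have hr0 : 0 ≤ r := hr ▸ Real.sqrt_nonneg _
  have hr2 : r ^ 2 = s ^ 2 + 4 * D := hr ▸ Real.sq_sqrt hdisc
  rw [← hr] at hϱ
  have hϱ0 : 0 < ϱ := by rw [hϱ]; positivity
  have hinv : ϱ⁻¹ = (r - s) / (2 * D) := by
    rw [inv_eq_iff_eq_inv, inv_div, hϱ, eq_div_iff]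
    · linear_combination hr2 / 2
    · intro h
      have : r = s := by linarith
      rw [this] at hr2
      exact hD0 (by linarith)
  refine ⟨?_, ?_⟩
  swap
  · have hsq : 1 + 4 * D⁻¹ / (s / D) ^ 2 = (s ^ 2 + 4 * D) / s ^ 2 := by
      field_simp
    rw [hsq, Real.sqrt_div hdisc, Real.sqrt_sq hs0.le, ← hr, hinv]
    field_simp
  have hfix : ϱ⁻¹ * (s + D * ϱ⁻¹) = 1 := by
    rw [hinv]
    field_simp
    linear_combination hr2
  obtain ⟨c, hc⟩ : ∃ c : ℕ → ℝ, c = fun k ↦ b k * td (k + 1) := ⟨_, rfl⟩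
  have hck : ∀ k, c k = b k * td (k + 1) := fun k ↦ by rw [hc]
  have shift : ∀ {f : ℕ → ℝ} {l : ℝ}, Tendsto f atTop (nhds l) →
      Tendsto (fun k ↦ f (k + 1)) atTop (nhds l) := fun h ↦ h.comp (tendsto_add_atTop_nat 1)
  have htl : Tendsto ta atTop (nhds s) := by
    have := ha.add ((hbl.mul (shift hθl)).div (shift hbl) h2)
    rw [mul_div_cancel_left₀ _ h2, ← hs] at this
    exact this.congr fun k ↦ (hta k).symm
  have hcl : Tendsto c atTop (nhds D) := by
    have := hbl.mul (shift (hd.sub ((ha.mul hθl).div hbl h2)))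
    rw [mul_sub, mul_div_cancel₀ _ h2, ← hD] at this
    exact this.congr fun k ↦ by simp [hck, htd]
  have hreci : ∀ k x, c k ≠ 0 → β k / (α k + x) = (ta k + c k * x)⁻¹ := by
    intro k x hk
    have hβ' : β k = (c k)⁻¹ := by rw [hβ, htb, hck, mul_inv]
    have hα' : α k + x = (ta k + c k * x) * (c k)⁻¹ := by
      rw [hα, htb, hck, mul_assoc, ← mul_inv, ← hck]
      field_simp
    rw [hβ', hα', div_mul_eq_div_div_swap, div_self (inv_ne_zero hk), one_div]
  have tails : ∀ ν : ℕ → ℝ,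
      (∀ᶠ k in atTop, c k ≠ 0 ∧ 0 < ν k ∧
        ∀ x, 0 ≤ x → x ≤ ν (k + 1) → (ν k)⁻¹ ≤ ta k + c k * x) →
      ∀ᶠ k in atTop, 0 ≤ ξt k ∧ ξt k ≤ ν k ∧ ξt k * (ta k + c k * ξt (k + 1)) = 1 := by
    intro ν hev
    obtain ⟨K, hK⟩ := eventually_atTop.1 hev
    filter_upwards [eventually_ge_atTop K] with k hk
    refine limit_tail_bounds (fun n hn ↦ ?_) (fun j n hj hjn ↦ ?_) (fun j hj ↦ (hK j hj).2.1)
      (fun j hj ↦ (hK j hj).2.2) hξtlim hk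
    · simpa using (hdiag n).trans (by simpa using hreci n 0 (hK n hn).1)
    · rw [hrec j n hjn, hreci j _ (hK j hj).1]
  have hcne : ∀ᶠ k in atTop, c k ≠ 0 := hcl.eventually_ne hD0
  rcases hD0.lt_or_gt with hneg | hpos
  · have hτ : ϱ⁻¹ ≤ -s / (2 * D) := by
      rw [hinv]
      exact div_le_div_of_nonpos_of_le (by linarith) (by linarith)
    have hcneg : ∀ᶠ k in atTop, c k < 0 := hcl.eventually_lt_const hneg
    suffices ∃ ν : ℕ → ℝ, Tendsto ν atTop (nhds (-s / (2 * D))) ∧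
        ∀ᶠ k in atTop, 0 < ν k ∧ (ν k)⁻¹ ≤ ta k + c k * ν (k + 1) by
      obtain ⟨ν, hν, hev⟩ := this
      have h := tails ν <| by
        filter_upwards [hcneg, hev] with k hk hk'
        exact ⟨hk.ne, hk'.1, fun x _ hx' ↦ hk'.2.trans <|
          add_le_add_right (mul_le_mul_of_nonpos_left hx' hk.le) _⟩
      exact tendsto_of_recursion_of_neg hneg htl hcl hν (h.mono fun _ h ↦ ⟨h.1, h.2.1⟩)
        (h.mono fun _ h ↦ h.2.2) hτ hfix
    have hv0 : 0 < -s / (2 * D) := div_pos_of_neg_of_neg (by linarith) (by linarith)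
    rcases hdisc.eq_or_lt with hz | hp
    · have haθ : a' = θ' := by nlinarith [sq_nonneg (a' - θ'), mul_nonneg hb0' hd0]
      have hbd : b' * d' = 0 := by rw [haθ] at hdisc'; linarith
      have ha1 : 0 < a' := by linarith
      have hv : -s / (2 * D) = a'⁻¹ := by
        rw [hs, hD, ← haθ, hbd]
        field_simp
        ring
      refine ⟨fun k ↦ (a k)⁻¹, hv ▸ ha.inv₀ ha1.ne', ?_⟩
      have hapos := ha.eventually_const_lt ha1
      filter_upwards [hapos, (tendsto_add_atTop_nat 1).eventually hapos] with k hk hk'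
      refine ⟨inv_pos.2 hk, ?_⟩
      have : ta k + c k * (a (k + 1))⁻¹ = a k + b k * d (k + 1) / a (k + 1) := by
        have := hb0 (k + 1)
        rw [hta, hck, htd]
        field_simp
        ring
      rw [this, inv_inv]
      exact le_add_of_nonneg_right
        (div_nonneg (mul_nonneg (hnn k).2.1 (hnn (k + 1)).2.2.1) hk'.le)
    · refine ⟨fun _ ↦ -s / (2 * D), tendsto_const_nhds, ?_⟩
      have hlt : (-s / (2 * D))⁻¹ < s + D * (-s / (2 * D)) := by
        have e1 : s + D * (-s / (2 * D)) = s / 2 := by field_simp; ring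
        rw [e1, inv_div, div_lt_iff_of_neg (by linarith)]
        nlinarith
      filter_upwards [(htl.add (hcl.mul_const _)).eventually_const_lt hlt] with k hk
      exact ⟨hv0, hk.le⟩
  · have h := tails (fun _ ↦ (s / 2)⁻¹) <| by
      filter_upwards [hcl.eventually_const_lt hpos,
        htl.eventually_const_lt (half_lt_self hs0)] with k hk hk'
      refine ⟨hk.ne', by positivity, fun x hx _ ↦ ?_⟩
      rw [inv_inv]
      nlinarith [mul_nonneg hk.le hx]
    exact tendsto_of_recursion_of_pos hs0 hpos htl hcl (h.mono fun _ h ↦ ⟨h.1, h.2.1⟩)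
      (h.mono fun _ h ↦ h.2.2) (inv_pos.2 hϱ0) hfix
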